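/- For every integer c ≥ 1 and every k ∈ {0,1,…,c}, the list Λ_{c,k}^2 is a Gray code. -/

import Mathlib

/-- `T(x)`: the list of pairs `(x_1,1), (x_2,2), …, (x_c,c)`, where pairs are
compared lexicographically (first by value, then by index). -/
def Tlist {c : ℕ} (x : Fin c → ℕ) : List (ℕ ×ₗ ℕ) :=
  List.ofFn fun i => toLex (x i, i.1 + 1)

/-- `T'(x)`: the list `T(x)` sorted lexicographically. -/
def Tsorted {c : ℕ} (x : Fin c → ℕ) : List (ℕ ×ₗ ℕ) :=
  List.insertionSort (· ≤ ·) (Tlist x)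

/-- Auxiliary comparison for the alternating lexicographic order.  The Boolean
argument records whether the current (1-based) position is odd; at the first
position where the two lists differ, the comparison is by `<` at odd positions
and by the reversed `<` at even positions. -/
def altB {α : Type*} [LinearOrder α] : Bool → List α → List α → Bool
  | _, [], _ => false
  | _, _ :: _, [] => false
  | oddPos, a :: as, b :: bs =>
      if a = b then altB (!oddPos) as bs
      else if oddPos then decide (a < b) else decide (b < a)

/-- The alternating lexicographic order `<_ALT`: if `j` is the first position where
the lists differ (positions numbered from 1), then `a <_ALT b` iff
`(a_j < b_j) XOR (j is even)`. -/
def altLt {α : Type*} [LinearOrder α] (a b : List α) : Prop := altB true a b = true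

/-- The Vortex order: `x <_VORTEX y` iff `T'(x) <_ALT T'(y)`. -/
def vortexLt {c : ℕ} (x y : Fin c → ℕ) : Prop := altLt (Tsorted x) (Tsorted y)

/-- The non-strict Vortex order. -/
def vortexLe {c : ℕ} (x y : Fin c → ℕ) : Prop := vortexLt x y ∨ x = y

instance {c : ℕ} : DecidableRel (@vortexLe c) := fun x y => by
  unfold vortexLe vortexLt altLt; infer_instance

/-- `VORTEX(N_1,…,N_c)`: the list of all tuples of `{1,…,N_1} × ⋯ × {1,…,N_c}`
sorted in increasing Vortex order. -/
noncomputable def vortexList {c : ℕ} (Ns : Fin c → ℕ) : List (Fin c → ℕ) :=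
  List.insertionSort vortexLe (Fintype.piFinset fun i => Finset.Icc 1 (Ns i)).toList

/-- `Λ_{c,k}^N`: `VORTEX(N,…,N,N-1,…,N-1)` with `c-k` copies of `N` followed by
`k` copies of `N-1`. -/
noncomputable def Lam (c k N : ℕ) : List (Fin c → ℕ) :=
  vortexList fun i => if i.1 < c - k then N else N - 1

/-- A list of tuples is a Gray code if every pair of consecutive tuples has
Hamming distance exactly 1. -/
def IsGrayCode {c : ℕ} (l : List (Fin c → ℕ)) : Prop :=
  l.Chain' fun x y => hammingDist x y = 1

theorem altB_self {α : Type*} [LinearOrder α] (b : Bool) (l : List α) : altB b l l = false := by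
  induction l generalizing b with
  | nil => rfl
  | cons a l ih => simp [altB, ih]

theorem altB_trans {α : Type*} [LinearOrder α] {b : Bool} {l m n : List α}
    (h₁ : altB b l m = true) (h₂ : altB b m n = true) : altB b l n = true := by
  induction l generalizing b m n with
  | nil => simp [altB] at h₁
  | cons x l ih =>
    cases m with
    | nil => simp [altB] at h₁
    | cons y m =>
      cases n with
      | nil => simp [altB] at h₂
      | cons z n =>
        simp only [altB] at *
        by_cases hxy : x = y
        · subst hxy
          by_cases hxz : x = z
          · subst hxz
            simp only [if_true] at *
            exact ih h₁ h₂
          · simpa [hxz] using h₂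
        · by_cases hyz : y = z
          · subst hyz
            simpa [hxy] using h₁
          · cases b <;> simp only [hxy, hyz, if_false, if_true, decide_eq_true_eq,
              Bool.false_eq_true] at h₁ h₂
            · have := h₂.trans h₁
              simp [this, this.ne']
            · have := h₁.trans h₂
              simp [this, this.ne]

theorem altB_total {α : Type*} [LinearOrder α] (b : Bool) {l m : List α}
    (hlen : l.length = m.length) (hne : l ≠ m) : altB b l m = true ∨ altB b m l = true := by
  induction l generalizing b m with
  | nil => cases m <;> simp_all
  | cons x l ih =>
    cases m with
    | nil => simp at hlen
    | cons y m =>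
      simp only [altB]
      by_cases hxy : x = y
      · subst hxy
        simpa using ih (!b) (by simpa using hlen) (by simpa using hne)
      · cases b <;> simp [hxy, Ne.symm hxy]

theorem altB_map {α β : Type*} [LinearOrder α] [LinearOrder β] {f : α → β} (hf : StrictMono f)
    (b : Bool) (l m : List α) : altB b (l.map f) (m.map f) = altB b l m := by
  induction l generalizing b m with
  | nil => cases m <;> rfl
  | cons x l ih =>
    cases m with
    | nil => rfl
    | cons y m => simp [altB, ih, hf.injective.eq_iff, hf.lt_iff_lt]

theorem altB_not {α : Type*} [LinearOrder α] (b : Bool) {l m : List α}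
    (hlen : l.length = m.length) : altB (!b) l m = altB b m l := by
  induction l generalizing b m with
  | nil => cases m <;> simp_all [altB]
  | cons x l ih =>
    cases m with
    | nil => simp at hlen
    | cons y m =>
      simp only [altB]
      by_cases hxy : x = y
      · subst hxy
        simpa using ih (!b) (by simpa using hlen)
      · cases b <;> simp [hxy, Ne.symm hxy]

theorem mem_Tlist {c : ℕ} {x : Fin c → ℕ} {p : ℕ ×ₗ ℕ} :
    p ∈ Tlist x ↔ ∃ i : Fin c, toLex (x i, i.1 + 1) = p := by
  simp [Tlist, List.mem_ofFn]

theorem mem_Tsorted {c : ℕ} {x : Fin c → ℕ} {p : ℕ ×ₗ ℕ} :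
    p ∈ Tsorted x ↔ ∃ i : Fin c, toLex (x i, i.1 + 1) = p := by
  rw [Tsorted, List.mem_insertionSort, mem_Tlist]

theorem length_Tsorted {c : ℕ} (x : Fin c → ℕ) : (Tsorted x).length = c := by
  simp [Tsorted, Tlist]

theorem Tsorted_injective {c : ℕ} : Function.Injective (@Tsorted c) := by
  intro x y h
  funext i
  have hi : toLex (x i, i.1 + 1) ∈ Tsorted y := h ▸ mem_Tsorted.2 ⟨i, rfl⟩
  obtain ⟨j, hj⟩ := mem_Tsorted.1 hi
  have hj' := toLex.injective hj
  simp only [Prod.mk.injEq, add_left_inj] at hj'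
  rw [← hj'.1, Fin.ext hj'.2]

theorem vortexLt_irrefl {c : ℕ} (x : Fin c → ℕ) : ¬ vortexLt x x := by
  simp [vortexLt, altLt, altB_self]

theorem vortexLt_trans {c : ℕ} {x y z : Fin c → ℕ} (h₁ : vortexLt x y) (h₂ : vortexLt y z) :
    vortexLt x z :=
  altB_trans h₁ h₂

instance vortexLe_isTrans {c : ℕ} : IsTrans (Fin c → ℕ) vortexLe where
  trans x y z := by
    rintro (h₁ | rfl) (h₂ | rfl)
    · exact Or.inl (vortexLt_trans h₁ h₂)
    · exact Or.inl h₁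
    · exact Or.inl h₂
    · exact Or.inr rfl

instance vortexLe_antisymm {c : ℕ} : Std.Antisymm (@vortexLe c) where
  antisymm x y := by
    rintro (h₁ | rfl) (h₂ | h₂)
    · exact absurd (vortexLt_trans h₁ h₂) (vortexLt_irrefl x)
    · exact h₂.symm
    · rfl
    · rfl

instance vortexLe_total {c : ℕ} : Std.Total (@vortexLe c) where
  total x y := by
    by_cases hxy : x = y
    · exact Or.inl (Or.inr hxy)
    · exact (altB_total true ((length_Tsorted x).trans (length_Tsorted y).symm)
        (Tsorted_injective.ne hxy)).imp Or.inl Or.inl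

/-- The map raising the index of a pair by one. -/
def shiftIndex (p : ℕ ×ₗ ℕ) : ℕ ×ₗ ℕ := toLex ((ofLex p).1, (ofLex p).2 + 1)

theorem shiftIndex_strictMono : StrictMono shiftIndex := by
  intro p q h
  rw [Prod.Lex.lt_iff] at h ⊢
  simpa [shiftIndex] using h

theorem Tsorted_cons {c : ℕ} (a : ℕ) (x : Fin c → ℕ) :
    Tsorted (Fin.cons a x : Fin (c + 1) → ℕ) =
      List.orderedInsert (· ≤ ·) (toLex (a, 1)) ((Tsorted x).map shiftIndex) := by
  have h : Tlist (Fin.cons a x : Fin (c + 1) → ℕ) =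
      toLex (a, 1) :: (Tlist x).map shiftIndex := by
    simp [Tlist, List.ofFn_succ, List.map_ofFn, Function.comp_def, shiftIndex]
  rw [Tsorted, h, List.insertionSort_cons, Tsorted,
    ← List.map_insertionSort (r := (· ≤ ·)) (s := (· ≤ ·)) shiftIndex _
      fun p _ q _ => shiftIndex_strictMono.le_iff_le.symm]

theorem pairwise_Tsorted {c : ℕ} (x : Fin c → ℕ) : (Tsorted x).Pairwise (· ≤ ·) :=
  List.pairwise_insertionSort (· ≤ ·) _

theorem mem_map_shiftIndex_Tsorted {c : ℕ} {x : Fin c → ℕ} {p : ℕ ×ₗ ℕ} :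
    p ∈ (Tsorted x).map shiftIndex ↔ ∃ i : Fin c, toLex (x i, i.1 + 2) = p := by
  simp [mem_Tsorted, shiftIndex]

theorem Tsorted_cons_one {c : ℕ} {x : Fin c → ℕ} (hx : ∀ i, 1 ≤ x i) :
    Tsorted (Fin.cons 1 x : Fin (c + 1) → ℕ) =
      toLex (1, 1) :: (Tsorted x).map shiftIndex := by
  rw [Tsorted_cons]
  cases h : (Tsorted x).map shiftIndex with
  | nil => rfl
  | cons p l =>
    apply List.orderedInsert_cons_of_le
    obtain ⟨i, rfl⟩ := mem_map_shiftIndex_Tsorted.1 (h ▸ List.mem_cons_self)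
    have := hx i
    rw [Prod.Lex.le_iff]
    simp
    omega

/-- If the values of two sorted lists with the same indices do not exceed `v`, then inserting in
both a pair of value `v` whose index is smaller than all others does not affect their alternating
lexicographic comparison. -/
theorem altB_orderedInsert {v k : ℕ} {l m : List (ℕ ×ₗ ℕ)} (b : Bool)
    (hl : l.Pairwise (· ≤ ·)) (hm : m.Pairwise (· ≤ ·))
    (hperm : (l.map fun p => (ofLex p).2).Perm (m.map fun p => (ofLex p).2))
    (hlv : ∀ p ∈ l, (ofLex p).1 ≤ v ∧ k < (ofLex p).2)
    (hmv : ∀ p ∈ m, (ofLex p).1 ≤ v ∧ k < (ofLex p).2) :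
    altB b (l.orderedInsert (· ≤ ·) (toLex (v, k))) (m.orderedInsert (· ≤ ·) (toLex (v, k))) =
      altB b l m := by
  have hconst : ∀ {q : ℕ ×ₗ ℕ} {n : List (ℕ ×ₗ ℕ)}, (q :: n).Pairwise (· ≤ ·) →
      (∀ p ∈ q :: n, (ofLex p).1 ≤ v ∧ k < (ofLex p).2) → toLex (v, k) ≤ q →
      ∀ p ∈ q :: n, (ofLex p).1 = v := by
    intro q n hn hv hq p hp
    have hqp : q ≤ p := by
      rcases List.mem_cons.1 hp with rfl | hp
      · exact le_rfl
      · exact (List.pairwise_cons.1 hn).1 p hp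
    have h := hq.trans hqp
    rw [Prod.Lex.le_iff] at h
    have := (hv p hp).1
    simp at h
    omega
  induction l generalizing b m with
  | nil =>
    obtain rfl : m = [] := by simpa using hperm
    simp [altB_self, altB]
  | cons p l ih =>
    cases m with
    | nil => simp at hperm
    | cons q m =>
      by_cases hp : toLex (v, k) ≤ p <;> by_cases hq : toLex (v, k) ≤ q
      · have hpc := hconst hl hlv hp
        have hqc := hconst hm hmv hq
        have key : p :: l = q :: m := by
          have hmap : ∀ n : List (ℕ ×ₗ ℕ), (∀ p ∈ n, (ofLex p).1 = v) →
              (n.map fun p => (ofLex p).2).map (fun i => toLex (v, i)) = n := by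
            intro n hn
            rw [List.map_map]
            refine (List.map_congr_left fun p hp => ?_).trans (List.map_id n)
            simp [← hn p hp]
          have := hperm.map fun i => (toLex (v, i) : ℕ ×ₗ ℕ)
          rw [hmap _ hpc, hmap _ hqc] at this
          exact this.eq_of_pairwise' hl hm
        rw [key, altB_self, altB_self]
      · have h1 : q < p := (not_le.1 hq).trans_le hp
        have h2 := not_le.1 hq
        simp [List.orderedInsert_cons, hp, hq, altB, h1.ne', h2.ne', h1, h2, h1.not_gt, h2.not_gt]
      · have h1 : p < q := (not_le.1 hp).trans_le hq
        have h2 := not_le.1 hp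
        simp [List.orderedInsert_cons, hp, hq, altB, h1.ne, h2.ne, h1, h2, h1.not_gt, h2.not_gt]
      · simp only [List.orderedInsert_cons, hp, hq, if_false, altB]
        by_cases hpq : p = q
        · subst hpq
          simp only [if_true]
          exact ih _ hl.of_cons hm.of_cons (by simpa using hperm)
            (fun p hp => hlv p (List.mem_cons_of_mem _ hp))
            (fun p hp => hmv p (List.mem_cons_of_mem _ hp))
        · simp [hpq]

theorem vortexLt_cons_one {c : ℕ} {x y : Fin c → ℕ} (hx : ∀ i, 1 ≤ x i) (hy : ∀ i, 1 ≤ y i) :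
    vortexLt (Fin.cons 1 x : Fin (c + 1) → ℕ) (Fin.cons 1 y : Fin (c + 1) → ℕ) ↔
      vortexLt y x := by
  simp only [vortexLt, altLt]
  rw [Tsorted_cons_one hx, Tsorted_cons_one hy, altB, if_pos rfl, altB_map shiftIndex_strictMono,
    altB_not _ ((length_Tsorted x).trans (length_Tsorted y).symm)]

theorem map_snd_Tsorted_perm {c : ℕ} (x : Fin c → ℕ) :
    (((Tsorted x).map shiftIndex).map fun p => (ofLex p).2).Perm
      (List.ofFn fun i : Fin c => i.1 + 2) := by
  have h := ((List.perm_insertionSort (· ≤ ·) (Tlist x)).map shiftIndex).map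
    fun p => (ofLex p).2
  refine h.trans (List.Perm.of_eq ?_)
  simp [Tlist, List.map_ofFn, Function.comp_def, shiftIndex]

theorem vortexLt_cons_max {c v : ℕ} {x y : Fin c → ℕ} (hx : ∀ i, x i ≤ v) (hy : ∀ i, y i ≤ v) :
    vortexLt (Fin.cons v x : Fin (c + 1) → ℕ) (Fin.cons v y : Fin (c + 1) → ℕ) ↔
      vortexLt x y := by
  have hs : ∀ z : Fin c → ℕ, ((Tsorted z).map shiftIndex).Pairwise (· ≤ ·) := fun z =>
    (pairwise_Tsorted z).map _ fun _ _ h => shiftIndex_strictMono.monotone h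
  have hv : ∀ z : Fin c → ℕ, (∀ i, z i ≤ v) →
      ∀ p ∈ (Tsorted z).map shiftIndex, (ofLex p).1 ≤ v ∧ 1 < (ofLex p).2 := by
    intro z hz p hp
    obtain ⟨i, rfl⟩ := mem_map_shiftIndex_Tsorted.1 hp
    exact ⟨hz i, by simp⟩
  simp only [vortexLt, altLt]
  rw [Tsorted_cons, Tsorted_cons, altB_orderedInsert _ (hs x) (hs y)
    ((map_snd_Tsorted_perm x).trans (map_snd_Tsorted_perm y).symm) (hv x hx) (hv y hy),
    altB_map shiftIndex_strictMono]

theorem vortexLt_cons_one_cons {c a : ℕ} {x y : Fin c → ℕ} (ha : 1 < a) (hx : ∀ i, 1 ≤ x i)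
    (hy : ∀ i, 1 ≤ y i) :
    vortexLt (Fin.cons 1 x : Fin (c + 1) → ℕ) (Fin.cons a y : Fin (c + 1) → ℕ) := by
  simp only [vortexLt, altLt]
  rw [Tsorted_cons_one hx]
  cases h : Tsorted (Fin.cons a y : Fin (c + 1) → ℕ) with
  | nil => simpa [h] using length_Tsorted (Fin.cons a y : Fin (c + 1) → ℕ)
  | cons p l =>
    have hp : toLex (1, 1) < p := by
      obtain ⟨i, rfl⟩ := mem_Tsorted.1 (h ▸ List.mem_cons_self)
      rw [Prod.Lex.lt_iff]
      cases i using Fin.cases with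
      | zero => simp [ha]
      | succ i =>
        have := hy i
        simp
        omega
    simp [altB, hp, hp.ne]

theorem hammingDist_cons {c : ℕ} (a b : ℕ) (x y : Fin c → ℕ) :
    hammingDist (Fin.cons a x : Fin (c + 1) → ℕ) (Fin.cons b y : Fin (c + 1) → ℕ) =
      (if a = b then 0 else 1) + hammingDist x y := by
  simp only [hammingDist]
  rw [Fin.card_filter_univ_succ']
  by_cases h : a = b <;> simp [h]

theorem isGrayCode_map_cons {c : ℕ} (a : ℕ) {l : List (Fin c → ℕ)} (hl : IsGrayCode l) :
    IsGrayCode (l.map fun x => (Fin.cons a x : Fin (c + 1) → ℕ)) :=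
  List.isChain_map_of_isChain _ (fun x y h => by simpa [hammingDist_cons] using h) hl

theorem isGrayCode_reverse {c : ℕ} {l : List (Fin c → ℕ)} (hl : IsGrayCode l) :
    IsGrayCode l.reverse :=
  List.isChain_reverse.2 (hl.imp fun x y h => by rwa [hammingDist_comm])

/-- The vortex-sorted list of the tuples bounded by `Ns ≤ 2` is the reflected Gray code. -/
theorem exists_isGrayCode_pairwise_vortexLt {c : ℕ} (Ns : Fin c → ℕ)
    (hN : ∀ i, Ns i = 1 ∨ Ns i = 2) :
    ∃ l : List (Fin c → ℕ), IsGrayCode l ∧ l.Pairwise vortexLt ∧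
      ∀ x, x ∈ l ↔ ∀ i, 1 ≤ x i ∧ x i ≤ Ns i := by
  induction c with
  | zero =>
    exact ⟨[Fin.elim0], List.isChain_singleton _, List.pairwise_singleton _ _, fun x => by
      simp [Subsingleton.elim x Fin.elim0]⟩
  | succ c ih =>
    obtain ⟨l, hgray, hsort, hmem⟩ := ih (Fin.tail Ns) fun i => hN i.succ
    have hone : ∀ x ∈ l, ∀ i, 1 ≤ x i := fun x hx i => ((hmem x).1 hx i).1
    have htwo : ∀ x ∈ l, ∀ i, x i ≤ 2 := fun x hx i => by
      have h1 := ((hmem x).1 hx i).2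
      have h2 := hN i.succ
      simp only [Fin.tail] at h1
      omega
    have hgray₁ := isGrayCode_map_cons 1 (isGrayCode_reverse hgray)
    have hsort₁ : (l.reverse.map fun x => (Fin.cons 1 x : Fin (c + 1) → ℕ)).Pairwise vortexLt := by
      rw [List.pairwise_map, List.pairwise_reverse]
      exact hsort.imp_of_mem fun hx hy h => (vortexLt_cons_one (hone _ hy) (hone _ hx)).2 h
    have hcons : ∀ a (x : Fin c → ℕ) (z : Fin (c + 1) → ℕ),
        Fin.cons a x = z ↔ a = z 0 ∧ x = Fin.tail z := by
      intro a x z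
      constructor
      · rintro rfl
        simp
      · rintro ⟨rfl, rfl⟩
        simp
    rcases hN 0 with h0 | h0
    · refine ⟨_, hgray₁, hsort₁, fun z => ?_⟩
      simp only [List.mem_map, List.mem_reverse, hcons, Fin.forall_fin_succ, h0]
      have := hmem (Fin.tail z)
      simp only [Fin.tail] at this
      constructor
      · rintro ⟨x, hx, h1, rfl⟩
        exact ⟨by omega, this.1 hx⟩
      · rintro ⟨h1, h2⟩
        exact ⟨_, this.2 h2, by omega, rfl⟩
    · refine ⟨(l.reverse.map fun x => (Fin.cons 1 x : Fin (c + 1) → ℕ)) ++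
        l.map fun x => (Fin.cons 2 x : Fin (c + 1) → ℕ), ?_, ?_, fun z => ?_⟩
      · refine List.isChain_append.2 ⟨hgray₁, isGrayCode_map_cons 2 hgray, ?_⟩
        cases l with
        | nil => simp
        | cons x l => simp [hammingDist_cons]
      · refine List.pairwise_append.2 ⟨hsort₁, ?_, ?_⟩
        · rw [List.pairwise_map]
          exact hsort.imp_of_mem fun hx hy h => (vortexLt_cons_max (htwo _ hx) (htwo _ hy)).2 h
        · simp only [List.mem_map, List.mem_reverse]
          rintro _ ⟨x, hx, rfl⟩ _ ⟨y, hy, rfl⟩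
          exact vortexLt_cons_one_cons one_lt_two (hone x hx) (hone y hy)
      · simp only [List.mem_append, List.mem_map, List.mem_reverse, hcons, Fin.forall_fin_succ, h0]
        have := hmem (Fin.tail z)
        simp only [Fin.tail] at this
        constructor
        · rintro (⟨x, hx, h1, rfl⟩ | ⟨x, hx, h1, rfl⟩) <;> exact ⟨by omega, this.1 hx⟩
        · rintro ⟨h1, h2⟩
          obtain h | h : 1 = z 0 ∨ 2 = z 0 := by omega
          · exact Or.inl ⟨_, this.2 h2, h, rfl⟩
          · exact Or.inr ⟨_, this.2 h2, h, rfl⟩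

theorem vortexList_eq_of_pairwise {c : ℕ} {Ns : Fin c → ℕ} {l : List (Fin c → ℕ)}
    (hsort : l.Pairwise vortexLt) (hmem : ∀ x, x ∈ l ↔ ∀ i, 1 ≤ x i ∧ x i ≤ Ns i) :
    vortexList Ns = l := by
  have hnodup : l.Nodup := by
    refine hsort.imp ?_
    rintro x _ h rfl
    exact vortexLt_irrefl x h
  refine List.Perm.eq_of_pairwise' (r := vortexLe) (List.pairwise_insertionSort _ _)
    (hsort.imp Or.inl) ((List.perm_insertionSort _ _).trans ?_)
  rw [List.perm_ext_iff_of_nodup (Finset.nodup_toList _) hnodup]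
  intro x
  rw [Finset.mem_toList, Fintype.mem_piFinset, hmem]
  simp only [Finset.mem_Icc]

/-- For every `c ≥ 1` and every `k ∈ {0,1,…,c}`, the list `Λ_{c,k}^2` is a Gray
code. -/
theorem stmt16 (c k : ℕ) (hc : 1 ≤ c) (hk : k ≤ c) : IsGrayCode (Lam c k 2) := by
  obtain ⟨l, hgray, hsort, hmem⟩ := exists_isGrayCode_pairwise_vortexLt
    (fun i : Fin c => if i.1 < c - k then 2 else 2 - 1) fun i => by split_ifs <;> simp
  rw [Lam, vortexList_eq_of_pairwise hsort hmem]
  exact hgray
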